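/- For g = sl_2 and χ a generic semisimple p-character, the twist element c^χ_n is given by c^χ_n = Σ_{k=0}^{p-1} ((−1)^k / (k! · d^χ_n(d^χ_n − 1)⋯(d^χ_n − k + 1))) e^k ⊗ f^k, where d^χ_n ∈ k is the scalar by which h acts on the highest weight generator 1^χ_n of the baby Verma module Z^χ_n. -/

import Mathlib

/-!
STATEMENT 12.  Let `g = sl_2` over an algebraically closed field `k` of characteristic
`p > 0` with standard basis `e, h, f`, and let `χ` be a generic semisimple `p`-character
with `χ(e) = 0`.  Let `N = Z^χ_n` be the baby Verma module with highest weight generator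
`v = 1^χ_n` (so `e·v = 0`, `h·v = d·v` where `d = d^χ_n` is not an integer mod `p`), and
`M = (Z^χ_n)^*` its dual with lowest weight generator `w = 1^{-χ}_{-n}` (so `f·w = 0`,
`h·w = -d·w`), the vectors `e^i w ⊗ f^j v` (`0 ≤ i,j ≤ p-1`) being linearly independent.

The canonical `g`-invariant element of `(Z^χ_n)^* ⊗ Z^χ_n` corresponding to the
identity has the form `c^χ_n (w ⊗ v) = Σ_{k=0}^{p-1} A_k · (e^k w ⊗ f^k v)` with
`A_0 = 1`; the twist element is `c^χ_n = Σ_k A_k e^k ⊗ f^k`.  Claim: the `g`-invariance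
forces `A_k = (−1)^k / (k! · d(d−1)⋯(d−k+1))`, i.e.
`c^χ_n = Σ_{k=0}^{p-1} ((−1)^k / (k! · d(d−1)⋯(d−k+1))) e^k ⊗ f^k`.
-/

open TensorProduct

/-- The action of `e` on `f ^ (n + 1) v` for a highest weight vector `v` of weight `d`. -/
theorem highest_weight_raise_lower_pow {k N : Type*} [Field k] [AddCommGroup N] [Module k N]
    {e f h : Module.End k N} (hef : e * f - f * e = h)
    (hhf : h * f - f * h = -((2 : k) • f)) {d : k} {v : N} (hev : e v = 0)
    (hhv : h v = d • v) (n : ℕ) :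
    e ((f ^ (n + 1)) v) = (((n : k) + 1) * (d - n)) • (f ^ n) v := by
  have hf (x : N) : h (f x) = f (h x) - (2 : k) • f x := by
    have := LinearMap.congr_fun hhf x
    simp only [LinearMap.sub_apply, Module.End.mul_apply, LinearMap.neg_apply,
      LinearMap.smul_apply] at this
    rw [sub_eq_iff_eq_add] at this
    rw [this]
    abel
  have he (x : N) : e (f x) = f (e x) + h x := by
    rw [← hef]
    simp
  have hw (n : ℕ) : h ((f ^ n) v) = (d - 2 * n) • (f ^ n) v := by
    induction n with
    | zero => simp [hhv]
    | succ n ih =>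
      rw [pow_succ', Module.End.mul_apply, hf, ih, map_smul, ← sub_smul]
      congr 1
      push_cast
      ring
  induction n with
  | zero => simp [he, hev, hhv]
  | succ n ih =>
    rw [pow_succ', Module.End.mul_apply, he, ih, hw, map_smul, ← Module.End.mul_apply,
      ← pow_succ', ← add_smul]
    congr 1
    push_cast
    ring

/-- A linearly independent family admits dual functionals. -/
theorem LinearIndependent.exists_dual_eq_ite {k N ι : Type*} [Field k] [AddCommGroup N]
    [Module k N] [DecidableEq ι] {u : ι → N} (hu : LinearIndependent k u) (i : ι) :
    ∃ φ : N →ₗ[k] k, ∀ j, φ (u j) = if j = i then 1 else 0 := by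
  obtain ⟨g, hg⟩ := LinearMap.exists_leftInverse_of_injective
    (Finsupp.linearCombination k u) (LinearMap.ker_eq_bot.mpr hu)
  refine ⟨Finsupp.lapply i ∘ₗ g, fun j => ?_⟩
  have := LinearMap.congr_fun hg (Finsupp.single j 1)
  simp only [LinearMap.comp_apply, Finsupp.linearCombination_single, one_smul,
    LinearMap.id_apply] at this
  simp [this, Finsupp.single_apply]

theorem sl2_twist_element_formula
    (k : Type*) [Field k] [IsAlgClosed k] (p : ℕ) [Fact p.Prime] [CharP k p]
    -- `d = d^χ_n`, the scalar by which `h` acts on `1^χ_n`; genericity of `χ` means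
    -- `d` is not an integer mod `p`
    (d : k) (hd : ∀ j : ℕ, j ≤ p - 2 → d - (j : k) ≠ 0)
    -- `M = (Z^χ_n)^*` and `N = Z^χ_n` with their `sl_2`-actions
    (M N : Type*) [AddCommGroup M] [Module k M] [AddCommGroup N] [Module k N]
    (eM fM hM : Module.End k M) (eN fN hN : Module.End k N)
    -- the `sl_2` commutation relations on both modules
    (hefM : eM * fM - fM * eM = hM) (hheM : hM * eM - eM * hM = (2 : k) • eM)
    (hhfM : hM * fM - fM * hM = -((2 : k) • fM))
    (hefN : eN * fN - fN * eN = hN) (hheN : hN * eN - eN * hN = (2 : k) • eN)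
    (hhfN : hN * fN - fN * hN = -((2 : k) • fN))
    -- the lowest weight generator `w = 1^{-χ}_{-n}` of `M` and the highest weight
    -- generator `v = 1^χ_n` of `N`
    (w : M) (v : N) (hfw : fM w = 0) (hhw : hM w = -d • w)
    (hev : eN v = 0) (hhv : hN v = d • v)
    -- the vectors `e^i w ⊗ f^j v`, `0 ≤ i, j ≤ p-1`, are linearly independent
    (hindep : LinearIndependent k
      (fun ij : Fin p × Fin p => ((eM ^ (ij.1 : ℕ)) w) ⊗ₜ[k] ((fN ^ (ij.2 : ℕ)) v)))
    -- the coefficients of the canonical invariant element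
    -- `c^χ_n (w ⊗ v) = Σ_k A_k · (e^k w ⊗ f^k v)`, normalized by `A_0 = 1` and
    -- killed by the actions of `e`, `f` and `h` on the tensor product
    (A : ℕ → k) (hA0 : A 0 = 1)
    (hinvE : (LinearMap.rTensor N eM + LinearMap.lTensor M eN)
      (∑ j ∈ Finset.range p, A j • (((eM ^ j) w) ⊗ₜ[k] ((fN ^ j) v))) = 0)
    (hinvF : (LinearMap.rTensor N fM + LinearMap.lTensor M fN)
      (∑ j ∈ Finset.range p, A j • (((eM ^ j) w) ⊗ₜ[k] ((fN ^ j) v))) = 0)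
    (hinvH : (LinearMap.rTensor N hM + LinearMap.lTensor M hN)
      (∑ j ∈ Finset.range p, A j • (((eM ^ j) w) ⊗ₜ[k] ((fN ^ j) v))) = 0) :
    -- the coefficients are `A_m = (−1)^m / (m! · d(d−1)⋯(d−m+1))`
    ∀ m ≤ p - 1,
      A m = (-1) ^ m / ((Nat.factorial m : k) * ∏ j ∈ Finset.range m, (d - (j : k))) := by
  have hp : 0 < p := (Fact.out : p.Prime).pos
  have hfv : LinearIndependent k (fun j : Fin p => (fN ^ (j : ℕ)) v) := by
    have hinj : Function.Injective (fun j : Fin p => ((⟨0, hp⟩, j) : Fin p × Fin p)) :=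
      fun _ _ hab => congrArg Prod.snd hab
    refine LinearIndependent.of_comp (TensorProduct.mk k M N w) ?_
    convert hindep.comp _ hinj using 1
    funext j
    simp only [Function.comp_apply, TensorProduct.mk_apply, pow_zero, Module.End.one_apply]
  have hne (m : ℕ) (hm : m < p) : (eM ^ m) w ≠ 0 := fun h0 =>
    hindep.ne_zero (⟨m, hm⟩, ⟨0, hp⟩) (by simp [h0])
  have hrec (m : ℕ) (hm : m + 1 < p) : A m + A (m + 1) * ((m + 1) * (d - m)) = 0 := by
    obtain ⟨φ, hφ⟩ := hfv.exists_dual_eq_ite ⟨m, by omega⟩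
    have hφ' (j : ℕ) (hj : j < p) : φ ((fN ^ j) v) = if j = m then 1 else 0 := by
      simpa using hφ ⟨j, hj⟩
    have key := congrArg ((TensorProduct.rid k M).toLinearMap ∘ₗ LinearMap.lTensor M φ) hinvE
    simp only [map_sum, map_smul, LinearMap.add_apply, LinearMap.rTensor_tmul,
      LinearMap.lTensor_tmul, map_add, LinearMap.comp_apply, LinearEquiv.coe_coe,
      TensorProduct.rid_tmul, map_zero, smul_add, Finset.sum_add_distrib] at key
    have h1 : ∑ j ∈ Finset.range p, A j • φ ((fN ^ j) v) • eM ((eM ^ j) w)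
        = A m • (eM ^ (m + 1)) w := by
      rw [Finset.sum_eq_single_of_mem m (Finset.mem_range.mpr (by omega))]
      · rw [hφ' m (by omega), if_pos rfl, one_smul, pow_succ', Module.End.mul_apply]
      · intro j hj hjm
        rw [hφ' j (Finset.mem_range.mp hj), if_neg hjm, zero_smul, smul_zero]
    have h2 : ∑ j ∈ Finset.range p, A j • φ (eN ((fN ^ j) v)) • (eM ^ j) w
        = (A (m + 1) * ((m + 1) * (d - m))) • (eM ^ (m + 1)) w := by
      rw [Finset.sum_eq_single_of_mem (m + 1) (Finset.mem_range.mpr hm)]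
      · rw [highest_weight_raise_lower_pow hefN hhfN hev hhv, map_smul, hφ' m (by omega),
          if_pos rfl, smul_eq_mul, mul_one, smul_smul]
      · rintro (_ | j) hj hjm
        · simp [hev]
        · rw [highest_weight_raise_lower_pow hefN hhfN hev hhv, map_smul,
            hφ' j (by have := Finset.mem_range.mp hj; omega), if_neg (by omega)]
          simp
    rw [h1, h2, ← add_smul] at key
    exact (smul_eq_zero.mp key).resolve_right (hne _ hm)
  intro m
  induction m with
  | zero => simp [hA0]
  | succ m ih =>
    intro hm
    have hr := hrec m (by omega)
    have hm0 : ((m : k) + 1) ≠ 0 := by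
      have : ((m + 1 : ℕ) : k) ≠ 0 := fun h0 =>
        Nat.not_dvd_of_pos_of_lt (by omega) (by omega) ((CharP.cast_eq_zero_iff k p _).mp h0)
      simpa using this
    have hdm : d - (m : k) ≠ 0 := hd m (by omega)
    have hA : A (m + 1) = -A m / ((m + 1) * (d - m)) := by
      rw [eq_div_iff (mul_ne_zero hm0 hdm)]
      linear_combination hr
    rw [hA, ih (by omega), Finset.prod_range_succ, Nat.factorial_succ, pow_succ, ← neg_div,
      div_div]
    push_cast
    congr 1 <;> ring
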